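/- The MPPC energy attains its minimum over the class of multiple curves: there exists a multiple curve γ* such that E(γ*) ≤ E(γ) for every multiple curve γ. -/

import Mathlib

open MeasureTheory Metric Set

noncomputable section

/-- A multiple curve: a finite family of Lipschitz curves `[0,1] → ℝ^d`. -/
structure MultiCurve (d : ℕ) where
  k : ℕ
  hk : 1 ≤ k
  curves : Fin k → ℝ → EuclideanSpace ℝ (Fin d)
  lipschitz : ∀ i, ∃ C : NNReal, LipschitzOnWith C (curves i) (Set.Icc 0 1)

/-- The image `Γ` of a multiple curve. -/
def MultiCurve.image {d : ℕ} (γ : MultiCurve d) : Set (EuclideanSpace ℝ (Fin d)) :=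
  ⋃ i, γ.curves i '' Set.Icc 0 1

/-- The total length of a multiple curve: sum of total variations over `[0,1]`. -/
def MultiCurve.length {d : ℕ} (γ : MultiCurve d) : ℝ :=
  ∑ i, (eVariationOn (γ.curves i) (Set.Icc 0 1)).toReal

/-- The MPPC energy. -/
def mppcEnergy {d : ℕ} (μ : Measure (EuclideanSpace ℝ (Fin d))) (p lam₁ lam₂ : ℝ)
    (γ : MultiCurve d) : ℝ :=
  (∫ x, Metric.infDist x γ.image ^ p ∂μ) + lam₁ * (γ.length + lam₂ * ((γ.k : ℝ) - 1))

/-- The support of a measure: points all of whose neighborhoods have positive measure. -/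
def msupport {d : ℕ} (μ : Measure (EuclideanSpace ℝ (Fin d))) : Set (EuclideanSpace ℝ (Fin d)) :=
  {x | ∀ ε > 0, 0 < μ (Metric.ball x ε)}

end

open scoped BoundedContinuousFunction

/-- A Lipschitz curve on `[0,1]` can be reparametrized so that its Lipschitz constant is its
total variation. -/
theorem LipschitzOnWith.exists_reparam_eVariationOn {E : Type*} [MetricSpace E] {f : ℝ → E}
    {C : NNReal} (hf : LipschitzOnWith C f (Icc 0 1)) :
    ∃ g : Icc (0 : ℝ) 1 → E,
      (∀ u v, dist (g u) (g v) ≤ (eVariationOn f (Icc 0 1)).toReal * dist u v) ∧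
      ∀ t ∈ Icc (0 : ℝ) 1, ∃ u, g u = f t := by
  have hle : ∀ s t : ℝ, 0 ≤ s → s ≤ t → t ≤ 1 →
      eVariationOn f (Icc s t) ≤ ENNReal.ofReal (C * (t - s)) := by
    intro s t hs hst ht
    have h := (hf.mono (Icc_subset_Icc hs ht)).comp_eVariationOn_le (g := id) (mapsTo_id (Icc s t))
    rw [eVariationOn_id_Icc, Function.comp_id] at h
    rwa [ENNReal.ofReal_mul C.coe_nonneg, ENNReal.ofReal_coe_nnreal]
  have hfin : ∀ s t : ℝ, 0 ≤ s → s ≤ t → t ≤ 1 → eVariationOn f (Icc s t) ≠ ⊤ :=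
    fun s t hs hst ht => ((hle s t hs hst ht).trans_lt ENNReal.ofReal_lt_top).ne
  set V : ℝ → ℝ := fun t => (eVariationOn f (Icc 0 t)).toReal with hV
  have hadd : ∀ s t : ℝ, 0 ≤ s → s ≤ t → t ≤ 1 →
      V t = V s + (eVariationOn f (Icc s t)).toReal := by
    intro s t hs hst ht
    have h := eVariationOn.Icc_add_Icc f (s := univ) hs hst (mem_univ s)
    simp only [univ_inter] at h
    rw [hV, ← ENNReal.toReal_add (hfin 0 s le_rfl hs (hst.trans ht)) (hfin s t hs hst ht), h]
  have hV0 : V 0 = 0 := by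
    simp [hV, eVariationOn.subsingleton]
  have hdist : ∀ s t : ℝ, 0 ≤ s → s ≤ t → t ≤ 1 → dist (f s) (f t) ≤ V t - V s := by
    intro s t hs hst ht
    rw [hadd s t hs hst ht, add_sub_cancel_left, dist_edist]
    exact ENNReal.toReal_mono (hfin s t hs hst ht)
      (eVariationOn.edist_le f (left_mem_Icc.2 hst) (right_mem_Icc.2 hst))
  have hdist' : ∀ s ∈ Icc (0 : ℝ) 1, ∀ t ∈ Icc (0 : ℝ) 1, dist (f s) (f t) ≤ |V s - V t| := by
    intro s hs t ht
    rcases le_total s t with h | h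
    · exact (hdist s t hs.1 h ht.2).trans (by rw [abs_sub_comm]; exact le_abs_self _)
    · rw [dist_comm]
      exact (hdist t s ht.1 h hs.2).trans (le_abs_self _)
  have hmono : ∀ t ∈ Icc (0 : ℝ) 1, V t ∈ Icc 0 (V 1) := fun t ht =>
    ⟨ENNReal.toReal_nonneg, by
      rw [hadd t 1 ht.1 ht.2 le_rfl]; exact le_add_of_nonneg_right ENNReal.toReal_nonneg⟩
  have hcont : ContinuousOn V (Icc 0 1) := by
    refine LipschitzOnWith.continuousOn (K := C) (LipschitzOnWith.of_le_add_mul C ?_)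
    intro s hs t ht
    rcases le_total s t with h | h
    · have h1 := hadd s t hs.1 h ht.2
      have h2 : 0 ≤ (eVariationOn f (Icc s t)).toReal := ENNReal.toReal_nonneg
      have h3 : 0 ≤ C * dist s t := by positivity
      linarith
    · have h1 := hadd t s ht.1 h hs.2
      have h2 := ENNReal.toReal_le_of_le_ofReal
        (mul_nonneg C.coe_nonneg (sub_nonneg.2 h)) (hle t s ht.1 h hs.2)
      rw [Real.dist_eq, abs_of_nonneg (sub_nonneg.2 h)]
      linarith
  have hsurj : ∀ u : Icc (0 : ℝ) 1, ∃ t ∈ Icc (0 : ℝ) 1, V t = V 1 * u := by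
    intro u
    have h1 : 0 ≤ V 1 := ENNReal.toReal_nonneg
    refine intermediate_value_Icc zero_le_one hcont ?_
    rw [hV0]
    exact ⟨mul_nonneg h1 u.2.1, mul_le_of_le_one_right h1 u.2.2⟩
  choose τ hτ hτV using hsurj
  refine ⟨fun u => f (τ u), fun u v => ?_, fun t ht => ?_⟩
  · refine (hdist' _ (hτ u) _ (hτ v)).trans ?_
    rw [hτV, hτV, ← mul_sub, abs_mul, abs_of_nonneg (show 0 ≤ V 1 from ENNReal.toReal_nonneg)]
    exact le_rfl
  · obtain ⟨h0, h1⟩ := hmono t ht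
    have key : ∃ u : Icc (0 : ℝ) 1, V 1 * u = V t := by
      rcases (h0.trans h1).eq_or_lt with h | h
      · exact ⟨0, by rw [← h, zero_mul]; linarith⟩
      · exact ⟨⟨V t / V 1, by positivity, (div_le_one h).2 h1⟩, mul_div_cancel₀ _ h.ne'⟩
    obtain ⟨u, hu⟩ := key
    refine ⟨u, dist_le_zero.1 ((hdist' _ (hτ u) _ ht).trans ?_)⟩
    rw [hτV, hu, sub_self, abs_zero]

/-- Every bounded set of a Euclidean space is fixed pointwise by a nonexpansive map with values
in a compact set. -/
theorem exists_lipschitzWith_one_retraction {ι : Type*} [Fintype ι]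
    {K : Set (EuclideanSpace ℝ ι)} (hK : Bornology.IsBounded K) :
    ∃ (B : Set (EuclideanSpace ℝ ι)) (c : EuclideanSpace ℝ ι → EuclideanSpace ℝ ι),
      IsCompact B ∧ LipschitzWith 1 c ∧ (∀ x, c x ∈ B) ∧ K ⊆ B ∧ ∀ x ∈ B, c x = x := by
  obtain ⟨R, hR0, hR⟩ := hK.exists_pos_norm_le
  have hRR : -R ≤ R := by linarith
  refine ⟨EuclideanSpace.equiv ι ℝ ⁻¹' Set.pi univ fun _ => Icc (-R) R,
    fun x => WithLp.toLp 2 fun i => (projIcc (-R) R hRR (x i) : ℝ), ?_, ?_, ?_, ?_, ?_⟩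
  · exact (EuclideanSpace.equiv ι ℝ).toHomeomorph.isCompact_preimage.2
      (isCompact_univ_pi fun _ => isCompact_Icc)
  · refine LipschitzWith.of_dist_le' (K := 1) ?_ |>.weaken (by simp)
    intro x y
    rw [one_mul, EuclideanSpace.dist_eq, EuclideanSpace.dist_eq]
    gcongr with i
    exact abs_projIcc_sub_projIcc hRR
  · exact fun x i _ => (projIcc (-R) R hRR (x i)).2
  · exact fun x hx i _ => abs_le.1 ((PiLp.norm_apply_le x i).trans (hR x hx))
  · intro x hx
    ext i
    have := hx i (mem_univ i)
    exact congrArg Subtype.val (projIcc_of_mem hRR this)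

theorem ae_mem_msupport {d : ℕ} (μ : Measure (EuclideanSpace ℝ (Fin d))) :
    ∀ᵐ x ∂μ, x ∈ msupport μ := by
  filter_upwards [Measure.support_mem_ae (μ := μ)] with x hx
  exact fun ε hε => (Measure.mem_support_iff_forall x).1 hx _ (Metric.ball_mem_nhds x hε)

theorem integrable_infDist_rpow {E : Type*} [PseudoMetricSpace E] [MeasurableSpace E]
    [OpensMeasurableSpace E] [SecondCountableTopology E] {μ : Measure E} [IsFiniteMeasure μ]
    {B S : Set E} {p : ℝ} (hp : 0 ≤ p) (hB : Bornology.IsBounded B) (hμ : ∀ᵐ x ∂μ, x ∈ B) :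
    Integrable (fun x => Metric.infDist x S ^ p) μ := by
  have hc : Continuous fun x : E => Metric.infDist x S ^ p :=
    (Metric.continuous_infDist_pt S).rpow_const fun _ => Or.inr hp
  rcases S.eq_empty_or_nonempty with rfl | ⟨y, hy⟩
  · simp
  obtain ⟨R, hR⟩ := hB.subset_closedBall y
  refine Integrable.of_bound hc.aestronglyMeasurable (R ^ p) ?_
  filter_upwards [hμ] with x hx
  rw [Real.norm_of_nonneg (Real.rpow_nonneg Metric.infDist_nonneg _)]
  exact Real.rpow_le_rpow Metric.infDist_nonneg
    ((Metric.infDist_le_dist_of_mem hy).trans (hR hx)) hp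

section Relaxation

variable {E : Type*} [MetricSpace E]

/-- Families of `k` curves in `B` together with upper bounds, at most `L`, for their Lipschitz
constants. -/
def lipschitzFamilies (B : Set E) (k : ℕ) (L : ℝ) :
    Set ((Fin k → (Icc (0 : ℝ) 1 →ᵇ E)) × (Fin k → ℝ)) :=
  {q | ∀ i, (∀ u, q.1 i u ∈ B) ∧ q.2 i ∈ Icc 0 L ∧
    ∀ u v, dist (q.1 i u) (q.1 i v) ≤ q.2 i * dist u v}

theorem isCompact_lipschitzFamilies {B : Set E} (hB : IsCompact B) (k : ℕ) (L : ℝ) :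
    IsCompact (lipschitzFamilies B k L) := by
  let A : Set (Icc (0 : ℝ) 1 →ᵇ E) :=
    {f | (∀ u, f u ∈ B) ∧ ∀ u v, dist (f u) (f v) ≤ L * dist u v}
  have hA : IsCompact A := by
    refine BoundedContinuousFunction.arzela_ascoli₂ B hB A ?_ (fun f x hf => hf.1 x) ?_
    · simp only [A, ofPred_forall, ofPred_and]
      refine IsClosed.inter ?_ ?_
      · exact isClosed_iInter fun u =>
          hB.isClosed.preimage (f := fun f : Icc (0 : ℝ) 1 →ᵇ E => f u) (by fun_prop)
      · exact isClosed_iInter fun u => isClosed_iInter fun v =>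
          isClosed_le (by fun_prop) continuous_const
    · refine LipschitzWith.uniformEquicontinuous _ L.toNNReal (fun f => ?_) |>.equicontinuous
      exact LipschitzWith.of_dist_le' f.2.2
  refine ((isCompact_univ_pi fun _ : Fin k => hA).prod
    (isCompact_univ_pi fun _ : Fin k => isCompact_Icc (a := (0 : ℝ)) (b := L))).of_isClosed_subset
    ?_ ?_
  · simp only [lipschitzFamilies, ofPred_forall, ofPred_and]
    refine isClosed_iInter fun i => ((isClosed_iInter fun u => ?_).inter ((?_ : IsClosed _).inter
      (isClosed_iInter fun u => isClosed_iInter fun v => ?_)))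
    · exact hB.isClosed.preimage (f := fun q : (Fin k → (Icc (0 : ℝ) 1 →ᵇ E)) × (Fin k → ℝ) => q.1 i u)
        (by fun_prop)
    · exact isClosed_Icc.preimage ((continuous_apply i).comp continuous_snd)
    · exact isClosed_le (by fun_prop) (by fun_prop)
  · intro q hq
    refine ⟨fun i _ => ⟨(hq i).1, fun u v => ((hq i).2.2 u v).trans ?_⟩, fun i _ => (hq i).2.1⟩
    exact mul_le_mul_of_nonneg_right (hq i).2.1.2 dist_nonneg

theorem infDist_iUnion_range_le_add_dist {k : ℕ} [NeZero k] (x : E)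
    (f g : Fin k → (Icc (0 : ℝ) 1 →ᵇ E)) :
    Metric.infDist x (⋃ i, range (f i)) ≤ Metric.infDist x (⋃ i, range (g i)) + dist f g := by
  rw [← sub_le_iff_le_add]
  refine (Metric.le_infDist ⟨g 0 0, mem_iUnion.2 ⟨0, mem_range_self _⟩⟩).2 ?_
  intro y hy
  obtain ⟨i, u, rfl⟩ := mem_iUnion.1 hy
  have h1 : Metric.infDist x (⋃ i, range (f i)) ≤ dist x (f i u) :=
    Metric.infDist_le_dist_of_mem (mem_iUnion.2 ⟨i, mem_range_self _⟩)
  have h2 : dist (f i u) (g i u) ≤ dist f g :=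
    (BoundedContinuousFunction.dist_coe_le_dist u).trans (dist_le_pi_dist f g i)
  have h3 := dist_triangle_right x (f i u) (g i u)
  have h4 := dist_triangle x (g i u) (f i u)
  rw [dist_comm (g i u)] at h4
  linarith

/-- The energy of a family of curves in which lengths are replaced by prescribed numbers. -/
noncomputable def relaxedEnergy [MeasurableSpace E] (μ : Measure E) (p lam₁ lam₂ : ℝ) (k : ℕ)
    (q : (Fin k → (Icc (0 : ℝ) 1 →ᵇ E)) × (Fin k → ℝ)) : ℝ :=
  (∫ x, Metric.infDist x (⋃ i, range (q.1 i)) ^ p ∂μ) +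
    lam₁ * ((∑ i, q.2 i) + lam₂ * ((k : ℝ) - 1))

theorem continuousOn_relaxedEnergy [MeasurableSpace E] [OpensMeasurableSpace E]
    [SecondCountableTopology E] {μ : Measure E} [IsFiniteMeasure μ] {B : Set E}
    (hB : IsCompact B) (hμ : ∀ᵐ x ∂μ, x ∈ B) {p : ℝ} (hp : 0 ≤ p) (lam₁ lam₂ : ℝ)
    (k : ℕ) [NeZero k] (L : ℝ) :
    ContinuousOn (relaxedEnergy μ p lam₁ lam₂ k) (lipschitzFamilies B k L) := by
  refine ContinuousOn.add ?_ (by fun_prop)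
  refine MeasureTheory.continuousOn_of_dominated (bound := fun _ => Metric.diam B ^ p)
    (fun q _ => ?_) (fun q hq => ?_) (integrable_const _) (ae_of_all _ fun x => ?_)
  · exact ((Metric.continuous_infDist_pt _).rpow_const
      fun _ => Or.inr hp).aestronglyMeasurable
  · filter_upwards [hμ] with x hx
    rw [Real.norm_of_nonneg (Real.rpow_nonneg Metric.infDist_nonneg _)]
    refine Real.rpow_le_rpow Metric.infDist_nonneg (le_trans ?_
      (Metric.dist_le_diam_of_mem hB.isBounded hx ((hq 0).1 0))) hp
    exact Metric.infDist_le_dist_of_mem (mem_iUnion.2 ⟨0, mem_range_self _⟩)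
  · have h : Continuous fun f : Fin k → (Icc (0 : ℝ) 1 →ᵇ E) =>
        Metric.infDist x (⋃ i, range (f i)) :=
      (LipschitzWith.of_le_add (infDist_iUnion_range_le_add_dist x)).continuous
    exact ((h.comp continuous_fst).rpow_const fun _ => Or.inr hp).continuousOn

end Relaxation

/-- A multiple curve with energy at most the relaxed energy of a given family. -/
theorem exists_mppcEnergy_le_relaxedEnergy {d : ℕ} (μ : Measure (EuclideanSpace ℝ (Fin d)))
    (p : ℝ) {lam₁ : ℝ} (hlam₁ : 0 ≤ lam₁) (lam₂ : ℝ) {B : Set (EuclideanSpace ℝ (Fin d))}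
    {k : ℕ} (hk : 1 ≤ k) {L : ℝ}
    {q : (Fin k → (Icc (0 : ℝ) 1 →ᵇ EuclideanSpace ℝ (Fin d))) × (Fin k → ℝ)}
    (hq : q ∈ lipschitzFamilies B k L) :
    ∃ γ : MultiCurve d, mppcEnergy μ p lam₁ lam₂ γ ≤ relaxedEnergy μ p lam₁ lam₂ k q := by
  have hL : ∀ i, LipschitzWith (q.2 i).toNNReal
      (fun t : ℝ => q.1 i (projIcc 0 1 zero_le_one t)) := fun i => by
    have h1 : LipschitzWith (q.2 i).toNNReal (q.1 i) := LipschitzWith.of_dist_le' (hq i).2.2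
    simpa [Function.comp_def] using h1.comp (LipschitzWith.projIcc zero_le_one)
  let γ : MultiCurve d :=
    { k := k
      hk := hk
      curves := fun i t => q.1 i (projIcc 0 1 zero_le_one t)
      lipschitz := fun i => ⟨_, (hL i).lipschitzOnWith⟩ }
  have himage : γ.image = ⋃ i, range (q.1 i) := by
    refine iUnion_congr fun i => ?_
    ext y
    constructor
    · rintro ⟨t, -, rfl⟩
      exact mem_range_self _
    · rintro ⟨u, rfl⟩
      exact ⟨u, u.2, congrArg (q.1 i) (projIcc_val zero_le_one u)⟩
  have hlength : γ.length ≤ ∑ i, q.2 i := by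
    refine Finset.sum_le_sum fun i _ => ENNReal.toReal_le_of_le_ofReal (hq i).2.1.1 ?_
    have h := ((hL i).lipschitzOnWith (s := Icc 0 1)).comp_eVariationOn_le (g := id)
      (mapsTo_id (Icc (0 : ℝ) 1))
    rw [eVariationOn_id_Icc, sub_zero, ENNReal.ofReal_one, mul_one] at h
    exact h
  refine ⟨γ, ?_⟩
  unfold mppcEnergy relaxedEnergy
  rw [himage]
  gcongr

/-- Projecting to `B` and reparametrizing a multiple curve yields an admissible family with no
larger energy. -/
theorem exists_relaxedEnergy_le_mppcEnergy {d : ℕ} {μ : Measure (EuclideanSpace ℝ (Fin d))}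
    [IsFiniteMeasure μ] {p : ℝ} (hp : 0 ≤ p) (lam₁ lam₂ : ℝ)
    {B : Set (EuclideanSpace ℝ (Fin d))} (hB : Bornology.IsBounded B) (hμ : ∀ᵐ x ∂μ, x ∈ B)
    {c : EuclideanSpace ℝ (Fin d) → EuclideanSpace ℝ (Fin d)} (hc : LipschitzWith 1 c)
    (hcB : ∀ x, c x ∈ B) (hfix : ∀ x ∈ B, c x = x) {L : ℝ} (γ : MultiCurve d)
    (hL : γ.length ≤ L) :
    ∃ q ∈ lipschitzFamilies B γ.k L,
      relaxedEnergy μ p lam₁ lam₂ γ.k q ≤ mppcEnergy μ p lam₁ lam₂ γ := by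
  have hg : ∀ i, ∃ g : Icc (0 : ℝ) 1 → EuclideanSpace ℝ (Fin d),
      (∀ u v, dist (g u) (g v) ≤ (eVariationOn (γ.curves i) (Icc 0 1)).toReal * dist u v) ∧
      ∀ t ∈ Icc (0 : ℝ) 1, ∃ u, g u = γ.curves i t := fun i => by
    obtain ⟨C, hC⟩ := γ.lipschitz i
    exact hC.exists_reparam_eVariationOn
  choose g hgdist hgsurj using hg
  have hcg : ∀ i u v, dist (c (g i u)) (c (g i v)) ≤
      (eVariationOn (γ.curves i) (Icc 0 1)).toReal * dist u v := fun i u v =>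
    (hc.dist_le_mul _ _).trans (by simpa using hgdist i u v)
  let f : Fin γ.k → (Icc (0 : ℝ) 1 →ᵇ EuclideanSpace ℝ (Fin d)) := fun i =>
    BoundedContinuousFunction.mkOfCompact
      ⟨fun u => c (g i u), (LipschitzWith.of_dist_le' (hcg i)).continuous⟩
  refine ⟨(f, fun i => (eVariationOn (γ.curves i) (Icc 0 1)).toReal), fun i => ⟨fun u => hcB _,
    ⟨ENNReal.toReal_nonneg, le_trans ?_ hL⟩, hcg i⟩, ?_⟩
  · exact Finset.single_le_sum (f := fun i => (eVariationOn (γ.curves i) (Icc 0 1)).toReal)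
      (fun _ _ => ENNReal.toReal_nonneg) (Finset.mem_univ i)
  have hne : γ.image.Nonempty :=
    ⟨_, mem_iUnion.2 ⟨⟨0, γ.hk⟩, mem_image_of_mem _ (left_mem_Icc.2 zero_le_one)⟩⟩
  refine add_le_add_left (α := ℝ) ?_ _
  refine integral_mono_ae (integrable_infDist_rpow hp hB hμ) (integrable_infDist_rpow hp hB hμ) ?_
  filter_upwards [hμ] with x hx
  refine Real.rpow_le_rpow Metric.infDist_nonneg ((Metric.le_infDist hne).2 fun y hy => ?_) hp
  obtain ⟨i, t, ht, rfl⟩ := mem_iUnion.1 hy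
  obtain ⟨u, hu⟩ := hgsurj i t ht
  calc Metric.infDist x (⋃ i, range (f i)) ≤ dist x (c (g i u)) :=
        Metric.infDist_le_dist_of_mem (mem_iUnion.2 ⟨i, u, rfl⟩)
    _ = dist (c x) (c (γ.curves i t)) := by rw [hfix x hx, hu]
    _ ≤ dist x (γ.curves i t) := by simpa using hc.dist_le_mul x (γ.curves i t)

/-- The MPPC energy attains its minimum over the class of multiple curves. -/
theorem mppc_exists_minimizer (d : ℕ) (hd : 2 ≤ d) (p lam₁ lam₂ : ℝ)
    (hp : 1 ≤ p) (hlam₁ : 0 < lam₁) (hlam₂ : 0 < lam₂)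
    (μ : Measure (EuclideanSpace ℝ (Fin d))) [IsFiniteMeasure μ]
    (hcs : IsCompact (msupport μ)) (hpos : 0 < μ Set.univ) :
    ∃ γs : MultiCurve d, ∀ γ : MultiCurve d,
      mppcEnergy μ p lam₁ lam₂ γs ≤ mppcEnergy μ p lam₁ lam₂ γ := by
  have hp0 : 0 ≤ p := zero_le_one.trans hp
  obtain ⟨B, c, hB, hc, hcB, hKB, hfix⟩ := exists_lipschitzWith_one_retraction hcs.isBounded
  have hμ : ∀ᵐ x ∂μ, x ∈ B := (ae_mem_msupport μ).mono fun x hx => hKB hx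
  let γ₀ : MultiCurve d :=
    { k := 1
      hk := le_rfl
      curves := fun _ _ => 0
      lipschitz := fun _ => ⟨0, (LipschitzWith.const _).lipschitzOnWith⟩ }
  set E₀ := mppcEnergy μ p lam₁ lam₂ γ₀
  have hsum : ∀ γ : MultiCurve d, mppcEnergy μ p lam₁ lam₂ γ ≤ E₀ →
      γ.length ≤ E₀ / lam₁ ∧ (γ.k : ℝ) ≤ E₀ / (lam₁ * lam₂) + 1 := by
    intro γ hγ
    have h1 : 0 ≤ ∫ x, Metric.infDist x γ.image ^ p ∂μ :=
      integral_nonneg fun x => Real.rpow_nonneg Metric.infDist_nonneg _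
    have h2 : 0 ≤ γ.length := Finset.sum_nonneg fun _ _ => ENNReal.toReal_nonneg
    have h3 : 0 ≤ (γ.k : ℝ) - 1 := sub_nonneg.2 (by exact_mod_cast γ.hk)
    unfold mppcEnergy at hγ
    have h4 := mul_nonneg hlam₁.le h2
    have h5 := mul_nonneg (mul_pos hlam₁ hlam₂).le h3
    constructor
    · rw [le_div_iff₀ hlam₁]
      linarith
    · rw [← sub_le_iff_le_add, le_div_iff₀ (mul_pos hlam₁ hlam₂)]
      linarith
  set L := E₀ / lam₁
  obtain ⟨N, hN⟩ := exists_nat_ge (E₀ / (lam₁ * lam₂) + 1)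
  have hmin : ∀ k : ℕ, 1 ≤ k → ∃ γs : MultiCurve d, ∀ γ : MultiCurve d, γ.k = k →
      γ.length ≤ L → mppcEnergy μ p lam₁ lam₂ γs ≤ mppcEnergy μ p lam₁ lam₂ γ := by
    intro k hk
    have : NeZero k := ⟨by omega⟩
    rcases (lipschitzFamilies B k L).eq_empty_or_nonempty with hempty | hne
    · refine ⟨γ₀, fun γ hγk hγL => ?_⟩
      obtain ⟨q, hq, -⟩ := exists_relaxedEnergy_le_mppcEnergy hp0 lam₁ lam₂ hB.isBounded hμ hc
        hcB hfix γ hγL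
      subst hγk
      simp [hempty] at hq
    · obtain ⟨q, hq, hqmin⟩ := (isCompact_lipschitzFamilies hB k L).exists_isMinOn hne
        (continuousOn_relaxedEnergy hB hμ hp0 lam₁ lam₂ k L)
      obtain ⟨γs, hγs⟩ := exists_mppcEnergy_le_relaxedEnergy μ p hlam₁.le lam₂ hk hq
      refine ⟨γs, fun γ hγk hγL => ?_⟩
      subst hγk
      obtain ⟨r, hr, hrle⟩ := exists_relaxedEnergy_le_mppcEnergy hp0 lam₁ lam₂ hB.isBounded hμ hc
        hcB hfix γ hγL
      exact hγs.trans ((hqmin hr).trans hrle)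
  have : Nonempty (MultiCurve d) := ⟨γ₀⟩
  choose! γs hγs using hmin
  have hbound : ∀ γ : MultiCurve d, mppcEnergy μ p lam₁ lam₂ γ ≤ E₀ →
      γ.k ∈ Finset.Icc 1 N ∧ γ.length ≤ L := fun γ hγ =>
    ⟨Finset.mem_Icc.2 ⟨γ.hk, by exact_mod_cast (hsum γ hγ).2.trans hN⟩, (hsum γ hγ).1⟩
  obtain ⟨k, hk, hkmin⟩ := Finset.exists_min_image (Finset.Icc 1 N)
    (fun k => mppcEnergy μ p lam₁ lam₂ (γs k)) ⟨_, (hbound γ₀ le_rfl).1⟩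
  have hle : ∀ γ : MultiCurve d, mppcEnergy μ p lam₁ lam₂ γ ≤ E₀ →
      mppcEnergy μ p lam₁ lam₂ (γs k) ≤ mppcEnergy μ p lam₁ lam₂ γ := fun γ hγ =>
    (hkmin _ (hbound γ hγ).1).trans (hγs _ γ.hk γ rfl (hbound γ hγ).2)
  refine ⟨γs k, fun γ => ?_⟩
  rcases le_total (mppcEnergy μ p lam₁ lam₂ γ) E₀ with h | h
  · exact hle γ h
  · exact (hle γ₀ le_rfl).trans h
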